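/- arXiv:2002.09590 — 4 statements merged into one kernel-verified Lean document; each statement's English description precedes it below -/
import Mathlib

section
/- Let H be a nontrivial complex Hilbert space and let H₀ be the bounded linear operator on ℓ²(ℤ,H) defined by (H₀φ)(n) = 2φ(n) − φ(n+1) − φ(n−1). Then the spectrum of H₀ equals the real interval [0,4], viewed as a subset of ℂ; that is, σ(H₀) = {z ∈ ℂ : ∃ x ∈ [0,4] ⊆ ℝ, z = x}. -/
theorem aux_memlp {H : Type*} [NormedAddCommGroup H] (k : ℤ) (f : ℤ → H)
    (hf : Memℓp f 2) : Memℓp (fun n => f (n + k)) 2 := by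
  have h2 : (0:ℝ) < (2 : ENNReal).toReal := by norm_num
  rw [memℓp_gen_iff h2] at hf ⊢
  exact (Equiv.addRight k).summable_iff.mpr hf

noncomputable def auxShift (H : Type*) [NormedAddCommGroup H] [InnerProductSpace ℂ H] :
    lp (fun _ : ℤ => H) 2 ≃ₗᵢ[ℂ] lp (fun _ : ℤ => H) 2 where
  toFun φ := ⟨fun n => φ (n + 1), aux_memlp 1 _ (lp.memℓp φ)⟩
  invFun φ := ⟨fun n => φ (n + (-1)), aux_memlp (-1) _ (lp.memℓp φ)⟩
  map_add' φ ψ := by ext n; rfl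
  map_smul' c φ := by ext n; rfl
  left_inv φ := by ext n; simp
  right_inv φ := by ext n; simp
  norm_map' φ := by
    have h2 : (0:ℝ) < (2 : ENNReal).toReal := by norm_num
    rw [lp.norm_eq_tsum_rpow h2, lp.norm_eq_tsum_rpow h2]
    congr 1
    exact (Equiv.addRight (1:ℤ)).tsum_eq (fun n => ‖φ n‖ ^ (2 : ENNReal).toReal)

theorem aux_const_zero {H : Type*} [NormedAddCommGroup H] (g : ℕ → H)
    (h : ∀ n, ‖g (n + 1)‖ = ‖g n‖) (ht : Filter.Tendsto g Filter.atTop (nhds 0)) : g 0 = 0 := by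
  have hc : ∀ n, ‖g n‖ = ‖g 0‖ := by
    intro n
    induction n with
    | zero => rfl
    | succ k ih => rw [h, ih]
  have h1 := ht.norm
  simp only [hc, norm_zero] at h1
  exact norm_eq_zero.mp (tendsto_nhds_unique tendsto_const_nhds h1)

theorem aux_rec {H : Type*} [NormedAddCommGroup H] [InnerProductSpace ℂ H] (f : ℤ → H)
    (w : ℂ) (hw : ‖w‖ = 1) (h : ∀ n, n ≠ 0 → f n = w • f (n - 1))
    (ht : Filter.Tendsto f Filter.cofinite (nhds 0)) : f 0 = 0 ∧ f (-1) = 0 := by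
  constructor
  · refine aux_const_zero (fun n : ℕ => f n) (fun n => ?_) ?_
    · have := h ((n + 1 : ℕ) : ℤ) (by omega)
      rw [this, norm_smul, hw, one_mul]; simp
    · rw [← Nat.cofinite_eq_atTop]
      exact ht.comp (Nat.cast_injective.tendsto_cofinite)
  · have := aux_const_zero (fun n : ℕ => f (-1 - n)) (fun n => ?_) ?_
    · simpa using this
    · have := h (-1 - (n:ℤ)) (by omega)
      simp only [this, norm_smul, hw, one_mul]
      congr 2; push_cast; ring
    · rw [← Nat.cofinite_eq_atTop]
      refine ht.comp (Function.Injective.tendsto_cofinite ?_)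
      intro a b hab
      simpa using hab

theorem aux_tendsto {H : Type*} [NormedAddCommGroup H] (φ : lp (fun _ : ℤ => H) 2) :
    Filter.Tendsto (fun n => φ n) Filter.cofinite (nhds 0) := by
  have h2 : (0:ℝ) < (2 : ENNReal).toReal := by norm_num
  have h := ((memℓp_gen_iff h2).mp (lp.memℓp φ)).tendsto_cofinite_zero
  have h3 := h.sqrt
  rw [tendsto_zero_iff_norm_tendsto_zero]
  simpa using h3

/-- Let `H` be a nontrivial complex Hilbert space and `H₀` the bounded
operator on `ℓ²(ℤ,H)` given by `(H₀φ)(n) = 2φ(n) − φ(n+1) − φ(n−1)`. Then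
`σ(H₀) = [0,4] ⊆ ℂ`. -/
theorem spectrum_fibered_discrete_schrodinger
    (H : Type*) [NormedAddCommGroup H] [InnerProductSpace ℂ H] [CompleteSpace H]
    [Nontrivial H]
    (H0 : lp (fun _ : ℤ => H) 2 →L[ℂ] lp (fun _ : ℤ => H) 2)
    (hH0 : ∀ (φ : lp (fun _ : ℤ => H) 2) (n : ℤ),
      (H0 φ) n = (2 : ℂ) • φ n - φ (n + 1) - φ (n - 1)) :
    spectrum ℂ H0 = {z : ℂ | ∃ x : ℝ, x ∈ Set.Icc (0 : ℝ) 4 ∧ z = (x : ℂ)} := by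
  ext z
  constructor
  · intro hz
    let e := auxShift H
    let U : lp (fun _ : ℤ => H) 2 →L[ℂ] lp (fun _ : ℤ => H) 2 := e
    let V : lp (fun _ : ℤ => H) 2 →L[ℂ] lp (fun _ : ℤ => H) 2 := e.symm
    have hUV : star U = V := LinearIsometryEquiv.adjoint_eq_symm e
    have hVU : V * U = 1 := by ext φ : 1; exact e.symm_apply_apply φ
    have hH : H0 = 1 + 1 - U - V := by
      ext φ n
      rw [hH0, two_smul]
      rfl
    have h1 : H0 = star (1 - U) * (1 - U) := by
      rw [hH, star_sub, star_one, hUV, sub_mul, mul_sub, mul_sub, hVU, one_mul, one_mul, mul_one]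
      abel
    have h4 : algebraMap ℂ (lp (fun _ : ℤ => H) 2 →L[ℂ] lp (fun _ : ℤ => H) 2) 4
        = 1 + 1 + 1 + 1 := by
      rw [show (4:ℂ) = 1 + 1 + 1 + 1 by norm_num]
      simp only [map_add, map_one]
    have h2 : algebraMap ℂ _ 4 - H0 = star (1 + U) * (1 + U) := by
      rw [hH, star_add, star_one, hUV, add_mul, mul_add, mul_add, hVU, one_mul, one_mul, mul_one,
        h4]
      abel
    have hsa : IsSelfAdjoint H0 := by rw [h1]; exact IsSelfAdjoint.star_mul_self _
    have hre : z = (z.re : ℂ) := hsa.mem_spectrum_eq_re hz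
    refine ⟨z.re, ⟨?_, ?_⟩, hre⟩
    · have hm : z.re ∈ spectrum ℝ (star (1 - U) * (1 - U)) := by
        rw [← h1, ← spectrum.algebraMap_mem_iff ℂ]
        rw [hre] at hz; exact hz
      exact spectrum_star_mul_self_nonneg _ hm
    · have hm : 4 - z.re ∈ spectrum ℝ (star (1 + U) * (1 + U)) := by
        rw [← h2, ← spectrum.algebraMap_mem_iff ℂ]
        rw [← spectrum.singleton_sub_eq]
        refine ⟨4, rfl, z, hz, ?_⟩
        change 4 - z = ((4 - z.re : ℝ) : ℂ)
        rw [Complex.ofReal_sub, ← hre]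
        norm_num
      have := spectrum_star_mul_self_nonneg _ hm
      linarith
  · rintro ⟨x, ⟨hx0, hx4⟩, rfl⟩ hres
    obtain ⟨v, hv⟩ := exists_ne (0 : H)
    have hu : IsUnit (algebraMap ℂ _ (x:ℂ) - H0) := hres
    obtain ⟨u, hu⟩ := hu
    let φ := (↑u⁻¹ : lp (fun _ : ℤ => H) 2 →L[ℂ] lp (fun _ : ℤ => H) 2) (lp.single 2 (0:ℤ) v)
    have hφ : (algebraMap ℂ (lp (fun _ : ℤ => H) 2 →L[ℂ] lp (fun _ : ℤ => H) 2) (x:ℂ) - H0) φ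
        = lp.single 2 (0:ℤ) v := by
      rw [← hu]
      change ((u : lp (fun _ : ℤ => H) 2 →L[ℂ] lp (fun _ : ℤ => H) 2) * ↑u⁻¹) _ = _
      rw [Units.mul_inv]; rfl
    have hn : ∀ n : ℤ, (x:ℂ) • φ n - ((2 : ℂ) • φ n - φ (n + 1) - φ (n - 1))
        = (lp.single 2 (0:ℤ) v : lp (fun _ : ℤ => H) 2) n := by
      intro n
      rw [← hφ, ← hH0]; rfl
    let c : ℝ := 1 - x / 2
    let s : ℝ := Real.sqrt (1 - c ^ 2)
    have hcs : c ^ 2 + s ^ 2 = 1 := by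
      have : s ^ 2 = 1 - c ^ 2 := Real.sq_sqrt (by simp only [c]; nlinarith)
      linarith
    let w : ℂ := ⟨c, s⟩
    let w' : ℂ := ⟨c, -s⟩
    have hw' : ‖w'‖ = 1 := by
      rw [Complex.norm_def, Complex.normSq_mk, show c * c + -s * -s = 1 by linarith]; simp
    have hadd : w + w' = 2 - x := by
      apply Complex.ext <;> simp [w, w', c]; ring
    have hmul : w' * w = 1 := by
      apply Complex.ext
      · simp [w, w']; linarith
      · simp [w, w']; ring
    let ψ : ℤ → H := fun n => φ (n + 1) - w • φ n
    have hψ : ∀ n, ψ n - w' • ψ (n - 1) = (lp.single 2 (0:ℤ) v : lp (fun _ : ℤ => H) 2) n := by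
      intro n
      rw [← hn]
      simp only [ψ, sub_add_cancel, smul_sub, smul_smul, hmul, one_smul]
      have : (x:ℂ) = 2 - (w + w') := by rw [hadd]; ring
      rw [this]
      module
    have ht : Filter.Tendsto ψ Filter.cofinite (nhds 0) := by
      have h1 := aux_tendsto φ
      have h2 := h1.comp (add_left_injective (1:ℤ)).tendsto_cofinite
      simpa using h2.sub (h1.const_smul w)
    obtain ⟨ha, hb⟩ := aux_rec ψ w' hw' (fun n hn0 => by
      have := hψ n
      rw [lp.single_apply_ne _ _ _ hn0] at this
      exact sub_eq_zero.mp this) ht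
    have := hψ 0
    rw [lp.single_apply_self, zero_sub, ha, hb] at this
    simp at this
    exact hv this.symm
end

section
/- Let H be a complex Hilbert space, γ > 0, C > 0, and w : ℤ × ℤ → B(H) with ‖w(n,m)‖ ≤ C·e^{−γ(|n|+|m|)} for all (n,m) ∈ ℤ². Let Λ₁ ∈ B(H) and let Λ₂ ∈ B(H) be a compact operator. Then the operator V on ℓ²(ℤ,H) defined by (Vφ)(n) = ∑_{m∈ℤ} Λ₁(w(n,m)(Λ₂(φ(m)))) is a well-defined bounded operator and is compact. -/
/-- Let `γ, C > 0` and `w : ℤ × ℤ → B(H)` with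
`‖w(n,m)‖ ≤ C·e^{−γ(|n|+|m|)}`. Let `Λ₁ ∈ B(H)` and `Λ₂ ∈ B(H)` compact. Then the operator
`V` on `ℓ²(ℤ,H)` given by `(Vφ)(n) = ∑_m Λ₁(w(n,m)(Λ₂(φ(m))))` is a well-defined bounded
operator and is compact. -/
theorem perturbation_is_compact
    (H : Type*) [NormedAddCommGroup H] [InnerProductSpace ℂ H] [CompleteSpace H]
    (γ C : ℝ) (hγ : 0 < γ) (hC : 0 < C)
    (w : ℤ × ℤ → H →L[ℂ] H)
    (hw : ∀ n m : ℤ, ‖w (n, m)‖ ≤ C * Real.exp (-γ * (|(n : ℝ)| + |(m : ℝ)|)))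
    (Λ₁ Λ₂ : H →L[ℂ] H) (hΛ₂ : IsCompactOperator Λ₂) :
    ∃ V : lp (fun _ : ℤ => H) 2 →L[ℂ] lp (fun _ : ℤ => H) 2,
      (∀ (φ : lp (fun _ : ℤ => H) 2) (n : ℤ),
        HasSum (fun m : ℤ => Λ₁ (w (n, m) (Λ₂ (φ m)))) ((V φ) n)) ∧
      IsCompactOperator V := by
  classical
  have h1 : Summable (fun n : ℤ => Real.exp (-γ * |(n : ℝ)|)) := by
    have h0 : Summable (fun n : ℕ => Real.exp (n * (-γ))) :=
      Real.summable_exp_nat_mul_iff.mpr (by linarith)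
    apply Summable.of_nat_of_neg
    · refine h0.congr (fun n => ?_)
      simp [mul_comm]
    · refine h0.congr (fun n => ?_)
      simp [mul_comm]
  have h2 : Summable (fun p : ℤ × ℤ => Real.exp (-γ * |(p.1 : ℝ)|) * Real.exp (-γ * |(p.2 : ℝ)|)) :=
    h1.mul_of_nonneg h1 (fun _ => (Real.exp_pos _).le) (fun _ => (Real.exp_pos _).le)
  let A : ℤ × ℤ → (lp (fun _ : ℤ => H) 2 →L[ℂ] H) := fun p =>
    Λ₁ ∘L (w p ∘L (Λ₂ ∘L (lp.evalCLM ℂ (fun _ : ℤ => H) 2 p.2)))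
  let S : ℤ → (H →L[ℂ] lp (fun _ : ℤ => H) 2) := fun n =>
    lp.singleContinuousLinearMap ℂ (fun _ : ℤ => H) 2 n
  let T : ℤ × ℤ → (lp (fun _ : ℤ => H) 2 →L[ℂ] lp (fun _ : ℤ => H) 2) := fun p => S p.1 ∘L A p
  have hTapp : ∀ p φ, T p φ = lp.single 2 p.1 (Λ₁ (w p (Λ₂ (φ p.2)))) := fun p φ => rfl
  have hTn : ∀ p, ‖T p‖ ≤ (‖Λ₁‖ * C * ‖Λ₂‖) *
      (Real.exp (-γ * |(p.1 : ℝ)|) * Real.exp (-γ * |(p.2 : ℝ)|)) := by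
    intro p
    have hwp : ‖w p‖ ≤ C * (Real.exp (-γ * |(p.1 : ℝ)|) * Real.exp (-γ * |(p.2 : ℝ)|)) := by
      rw [← Real.exp_add, ← mul_add]
      exact hw p.1 p.2
    refine ContinuousLinearMap.opNorm_le_bound _ (by positivity) (fun φ => ?_)
    rw [hTapp, lp.norm_single (by norm_num)]
    have e : ‖φ p.2‖ ≤ ‖φ‖ := lp.norm_apply_le_norm (by norm_num) φ p.2
    calc ‖Λ₁ (w p (Λ₂ (φ p.2)))‖ ≤ ‖Λ₁‖ * (‖w p‖ * (‖Λ₂‖ * ‖φ p.2‖)) :=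
          Λ₁.le_opNorm_of_le ((w p).le_opNorm_of_le (Λ₂.le_opNorm _))
      _ ≤ ‖Λ₁‖ * ((C * (Real.exp (-γ * |(p.1 : ℝ)|) * Real.exp (-γ * |(p.2 : ℝ)|))) *
          (‖Λ₂‖ * ‖φ‖)) := by gcongr
      _ = _ := by ring
  have hT : Summable T := Summable.of_norm_bounded (h2.mul_left _) hTn
  have hTc : ∀ p, IsCompactOperator (T p) := by
    intro p
    have := hΛ₂.comp_clm (lp.evalCLM ℂ (fun _ : ℤ => H) 2 p.2)
    have := this.clm_comp (S p.1 ∘L (Λ₁ ∘L w p))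
    exact this
  refine ⟨∑' p, T p, fun φ n => ?_, ?_⟩
  · have h3 := hT.hasSum.mapL ((lp.evalCLM ℂ (fun _ : ℤ => H) 2 n) ∘L
      (ContinuousLinearMap.apply ℂ (lp (fun _ : ℤ => H) 2) φ))
    have hinj : Function.Injective (fun m : ℤ => (n, m)) := fun a b h => (Prod.mk.inj h).2
    rw [← hinj.hasSum_iff] at h3
    · convert h3 using 1
      · funext m
        change _ = (T (n, m) φ : ∀ _ : ℤ, H) n
        rw [hTapp, lp.single_apply_self]
      · rfl
    · rintro ⟨a, b⟩ hab
      change (T (a, b) φ : ∀ _ : ℤ, H) n = 0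
      rw [hTapp]
      apply lp.single_apply_ne
      rintro rfl
      exact hab ⟨b, rfl⟩
  · refine isCompactOperator_of_tendsto hT.hasSum (Filter.Eventually.of_forall fun s => ?_)
    exact (compactOperator (RingHom.id ℂ) (lp (fun _ : ℤ => H) 2)
      (lp (fun _ : ℤ => H) 2)).sum_mem (t := s) (f := T) (fun p _ => hTc p)
end

section
/- Let H be a complex Hilbert space, γ > 0, and Λ ∈ B(H) a compact operator. Then the bounded operator K on ℓ²(ℤ,H) defined by (Kφ)(n) = e^{−(γ/2)|n|}·Λ(φ(n)) is compact. (This is the compactness of the operator W_{−γ} ⊗ Λ, where W_{−γ} is multiplication by n ↦ e^{−(γ/2)|n|} on ℓ²(ℤ).) -/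
/-- Let `γ > 0` and `Λ ∈ B(H)` compact. Then the operator
`K = W_{−γ} ⊗ Λ` on `ℓ²(ℤ,H)`, `(Kφ)(n) = e^{−(γ/2)|n|}·Λ(φ(n))`, is compact. -/
theorem weighted_tensor_compact
    (H : Type*) [NormedAddCommGroup H] [InnerProductSpace ℂ H] [CompleteSpace H]
    (γ : ℝ) (hγ : 0 < γ) (Λ : H →L[ℂ] H) (hΛ : IsCompactOperator Λ)
    (K : lp (fun _ : ℤ => H) 2 →L[ℂ] lp (fun _ : ℤ => H) 2)
    (hK : ∀ (φ : lp (fun _ : ℤ => H) 2) (n : ℤ),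
      (K φ) n = (Real.exp (-(γ / 2) * |(n : ℝ)|) : ℂ) • Λ (φ n)) :
    IsCompactOperator K := by
  have hw : Summable (fun n : ℤ => Real.exp (-(γ / 2) * |(n : ℝ)|)) := by
    have h : Summable (fun n : ℕ => Real.exp (-(γ / 2) * (n : ℝ))) := by
      have := Real.summable_exp_nat_mul_iff.mpr (show -(γ / 2) < 0 by linarith)
      simpa only [mul_comm] using this
    apply Summable.of_nat_of_neg
    · simpa using h
    · simpa using h
  let A : ℤ → (lp (fun _ : ℤ => H) 2 →L[ℂ] lp (fun _ : ℤ => H) 2) := fun n =>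
    (lp.singleContinuousLinearMap ℂ (fun _ : ℤ => H) 2 n).comp
      (Λ.comp (lp.evalCLM ℂ (fun _ : ℤ => H) 2 n))
  let T : ℤ → (lp (fun _ : ℤ => H) 2 →L[ℂ] lp (fun _ : ℤ => H) 2) := fun n =>
    (Real.exp (-(γ / 2) * |(n : ℝ)|) : ℂ) • A n
  have hA : ∀ n φ, A n φ = lp.single 2 n (Λ (φ n)) := fun n φ => rfl
  have hAn : ∀ n, ‖A n‖ ≤ ‖Λ‖ := by
    intro n
    refine ContinuousLinearMap.opNorm_le_bound _ (norm_nonneg _) fun φ => ?_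
    rw [hA, lp.norm_single (by norm_num)]
    refine (Λ.le_opNorm _).trans ?_
    gcongr
    exact lp.norm_apply_le_norm (by norm_num) φ n
  have hT : Summable T := by
    refine Summable.of_norm_bounded (hw.mul_right ‖Λ‖) fun n => ?_
    simp only [T]
    rw [norm_smul, Complex.norm_real, Real.norm_eq_abs, Real.abs_exp]
    gcongr
    exact hAn n
  have hTc : ∀ n, IsCompactOperator (T n) := fun n =>
    ((hΛ.comp_clm (lp.evalCLM ℂ (fun _ : ℤ => H) 2 n)).clm_comp
      (lp.singleContinuousLinearMap ℂ (fun _ : ℤ => H) 2 n)).smul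
      (Real.exp (-(γ / 2) * |(n : ℝ)|) : ℂ)
  have hKT : K = ∑' n, T n := by
    ext φ m : 3
    have h1 := (hT.hasSum.mapL (ContinuousLinearMap.apply ℂ _ φ)).mapL
      (lp.evalCLM ℂ (fun _ : ℤ => H) 2 m)
    have h2 := h1.unique (hasSum_single m fun n hn => ?_)
    · refine Eq.trans ?_ h2.symm
      rw [hK]
      change _ = (Real.exp (-(γ / 2) * |(m : ℝ)|) : ℂ) • (lp.single 2 m (Λ (φ m)) : lp (fun _ : ℤ => H) 2) m
      rw [lp.single_apply_self]
    · change (Real.exp (-(γ / 2) * |(n : ℝ)|) : ℂ) • (lp.single 2 n (Λ (φ n)) : lp (fun _ : ℤ => H) 2) m = 0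
      rw [lp.single_apply_ne _ _ _ hn.symm, smul_zero]
  rw [hKT]
  refine isCompactOperator_of_tendsto hT.hasSum (Filter.Eventually.of_forall fun s => ?_)
  exact (compactOperator (RingHom.id ℂ) _ _).sum_mem fun n _ => hTc n
end

section
/- Let α ∈ (0,π) be real and define g : ℝ → ℝ by g(θ) := arccos((cos α − tanh(2θ))/(1 − tanh(2θ)·cos α)). Then the denominator 1 − tanh(2θ)·cos α is strictly positive for every θ ∈ ℝ, g(0) = α, and for every θ ∈ ℝ the function g is differentiable at θ with derivative g′(θ) = 2·sin(g(θ)). That is, g is the flow-line through α of the vector field v(x) = 2 sin x on ℝ. -/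
/-- For real `α ∈ (0,π)`, the function
`g(θ) = arccos((cos α − tanh(2θ))/(1 − tanh(2θ)·cos α))` has strictly positive denominator,
satisfies `g(0) = α`, and is the flow-line through `α` of the vector field `v(x) = 2 sin x`:
`g′(θ) = 2 sin(g(θ))` for every real `θ`. -/
theorem flow_line_of_sine_field (α : ℝ) (hα : α ∈ Set.Ioo (0 : ℝ) Real.pi) :
    (∀ θ : ℝ, 0 < 1 - Real.tanh (2 * θ) * Real.cos α) ∧
    (fun θ : ℝ => Real.arccos
        ((Real.cos α - Real.tanh (2 * θ)) / (1 - Real.tanh (2 * θ) * Real.cos α))) 0 = α ∧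
    (∀ θ : ℝ, HasDerivAt
      (fun θ : ℝ => Real.arccos
        ((Real.cos α - Real.tanh (2 * θ)) / (1 - Real.tanh (2 * θ) * Real.cos α)))
      (2 * Real.sin (Real.arccos
        ((Real.cos α - Real.tanh (2 * θ)) / (1 - Real.tanh (2 * θ) * Real.cos α)))) θ) := by
  obtain ⟨h0, hpi⟩ := hα
  have hs : 0 < Real.sin α := Real.sin_pos_of_pos_of_lt_pi h0 hpi
  have hsc := Real.sin_sq_add_cos_sq α
  have hc1 : Real.cos α < 1 := by nlinarith
  have hc2 : -1 < Real.cos α := by nlinarith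
  have ht : ∀ x : ℝ, -1 < Real.tanh x ∧ Real.tanh x < 1 := fun x =>
    Real.tanh_bijOn.mapsTo (Set.mem_univ x)
  have hden : ∀ θ : ℝ, 0 < 1 - Real.tanh (2 * θ) * Real.cos α := by
    intro θ
    obtain ⟨h1, h2⟩ := ht (2 * θ)
    nlinarith [mul_pos (sub_pos.2 h2) (sub_pos.2 hc2), mul_pos (sub_pos.2 h1) (sub_pos.2 hc1)]
  have hdt : ∀ x : ℝ, HasDerivAt Real.tanh (1 - Real.tanh x ^ 2) x := by
    intro x
    have hch := (Real.cosh_pos x).ne'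
    have h := (Real.hasDerivAt_sinh x).div (Real.hasDerivAt_cosh x) hch
    have e : Real.tanh = Real.sinh / Real.cosh := by
      funext y
      simp [Real.tanh_eq_sinh_div_cosh]
    rw [← e] at h
    refine h.congr_deriv ?_
    rw [Real.tanh_eq_sinh_div_cosh]
    field_simp
  refine ⟨hden, ?_, ?_⟩
  · simp [Real.arccos_cos h0.le hpi.le]
  · intro θ
    have hd := hden θ
    obtain ⟨h1, h2⟩ := ht (2 * θ)
    have hT : HasDerivAt (fun θ : ℝ => Real.tanh (2 * θ))
        ((1 - Real.tanh (2 * θ) ^ 2) * 2) θ := by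
      have h2' : HasDerivAt (fun θ : ℝ => 2 * θ) 2 θ := by
        simpa using (hasDerivAt_id θ).const_mul (2 : ℝ)
      exact (hdt (2 * θ)).comp θ h2'
    have hU := (hT.const_sub (Real.cos α)).div ((hT.mul_const (Real.cos α)).const_sub 1) hd.ne'
    set t := Real.tanh (2 * θ) with htdef
    set c := Real.cos α with hcdef
    have hu : 1 - ((c - t) / (1 - t * c)) ^ 2 = (1 - c ^ 2) * (1 - t ^ 2) / (1 - t * c) ^ 2 := by
      rw [div_pow, eq_div_iff (pow_ne_zero 2 hd.ne'), sub_mul,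
        div_mul_cancel₀ _ (pow_ne_zero 2 hd.ne')]
      ring
    have hpos : 0 < 1 - ((c - t) / (1 - t * c)) ^ 2 := by
      rw [hu]
      have : 0 < 1 - c ^ 2 := by nlinarith
      have : 0 < 1 - t ^ 2 := by nlinarith
      positivity
    have hA := Real.hasDerivAt_arccos (x := (c - t) / (1 - t * c))
      (by intro h; rw [h] at hpos; norm_num at hpos)
      (by intro h; rw [h] at hpos; norm_num at hpos)
    have hF := hA.comp θ hU
    refine hF.congr_deriv ?_
    rw [Real.sin_arccos]
    have hU' : (-((1 - t ^ 2) * 2) * (1 - t * c) - (c - t) * -((1 - t ^ 2) * 2 * c)) /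
        (1 - t * c) ^ 2 = -2 * (1 - ((c - t) / (1 - t * c)) ^ 2) := by
      rw [hu]
      have := hd.ne'
      field_simp
      ring
    rw [hU']
    have hq := Real.sqrt_pos.2 hpos
    have hsq := Real.sq_sqrt hpos.le
    set w := 1 - ((c - t) / (1 - t * c)) ^ 2
    have h3 : -(1 / √w) * (-2 * w) = 2 * w / √w := by ring
    rw [h3, div_eq_iff hq.ne']
    linarith
end
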